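/- Let σ, w be Radon measures on ℝ^N. If 1<p≤2≤q<∞, then the quadratic 𝒜_{p,q}-constant equals the simple A_{p,q}-constant: [σ,w]_{p,q} = (σ,w)_{p,q}. -/

import Mathlib

open MeasureTheory ENNReal Set

noncomputable section

abbrev EucN (N : ℕ) := Fin N → ℝ

/-- The half-open cube `x + [0, 2^{-k})^N`. -/
def dyCube (N : ℕ) (k : ℤ) (x : EucN N) : Set (EucN N) :=
  {y | ∀ i, x i ≤ y i ∧ y i < x i + (2 : ℝ) ^ (-k)}

/-- A dyadic lattice on `ℝ^N`: for every `k ∈ ℤ`, `gen k` is a partition of `ℝ^N` into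
half-open cubes of side `2^{-k}`, and the generations are nested. -/
structure DyadicLattice (N : ℕ) where
  gen : ℤ → Set (Set (EucN N))
  cube_form : ∀ k Q, Q ∈ gen k → ∃ x, Q = dyCube N k x
  covers : ∀ k (y : EucN N), ∃ Q ∈ gen k, y ∈ Q
  pairwiseDisjoint : ∀ k, (gen k).PairwiseDisjoint id
  nested : ∀ k, ∀ Q ∈ gen (k + 1), ∃ R ∈ gen k, Q ⊆ R

namespace DyadicLattice
variable {N : ℕ}
/-- The collection `𝒟` of all dyadic cubes. -/
def cubes (D : DyadicLattice N) : Set (Set (EucN N)) := ⋃ k, D.gen k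
/-- `Q'` is a dyadic child of `Q`. -/
def child (D : DyadicLattice N) (Q Q' : Set (EucN N)) : Prop :=
  ∃ k, Q ∈ D.gen k ∧ Q' ∈ D.gen (k + 1) ∧ Q' ⊆ Q
/-- `R = Q^{(r)}` is the `r`-th dyadic ancestor of `Q`. -/
def anc (D : DyadicLattice N) (r : ℕ) (Q R : Set (EucN N)) : Prop :=
  ∃ k : ℤ, Q ∈ D.gen k ∧ R ∈ D.gen (k - r) ∧ Q ⊆ R
end DyadicLattice

/-- `ℝ≥0∞`-valued indicator of a set. -/
def indE {N : ℕ} (Q : Set (EucN N)) (x : EucN N) : ℝ≥0∞ := Q.indicator 1 x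

/-- `‖ (∑ i (f i)²)^{1/2} ‖_{L^p(μ)}` for a family of `ℝ≥0∞`-valued functions. -/
def sqNorm {N : ℕ} {ι : Type*} (μ : Measure (EucN N)) (p : ℝ)
    (f : ι → EucN N → ℝ≥0∞) : ℝ≥0∞ :=
  (∫⁻ x, (∑' i, f i x ^ 2) ^ (p / 2) ∂μ) ^ (1 / p)

/-- The quadratic `𝒜_{p,q}` constant `[σ,w]_{p,q}`: the least `C` such that for all real
coefficients `(a_Q)_{Q ∈ 𝒟}`,
`‖(∑_Q (a_Q σ(Q)/|Q|)² 1_Q)^{1/2}‖_{L^q(w)} ≤ C ‖(∑_Q a_Q² 1_Q)^{1/2}‖_{L^p(σ)}`. -/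
def sqA {N : ℕ} (D : DyadicLattice N) (σ w : Measure (EucN N)) (p q : ℝ) : ℝ≥0∞ :=
  sInf {C | ∀ a : Set (EucN N) → ℝ,
    sqNorm w q (fun Q : D.cubes => fun x =>
      (‖a (Q : Set (EucN N))‖₊ : ℝ≥0∞) * σ (Q : Set (EucN N)) / volume (Q : Set (EucN N))
        * indE (Q : Set (EucN N)) x)
    ≤ C * sqNorm σ p (fun Q : D.cubes => fun x =>
      (‖a (Q : Set (EucN N))‖₊ : ℝ≥0∞) * indE (Q : Set (EucN N)) x)}

/-- The simple (Muckenhoupt type) `A_{p,q}` constant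
`(σ,w)_{p,q} = sup_{Q ∈ 𝒟} σ(Q)^{1/p'} w(Q)^{1/q} / |Q|`. -/
def simpleA {N : ℕ} (D : DyadicLattice N) (σ w : Measure (EucN N)) (p q : ℝ) : ℝ≥0∞ :=
  ⨆ Q ∈ D.cubes, σ Q ^ (1 - 1 / p) * w Q ^ (1 / q) / volume Q

/-- Minkowski's inequality for countable sums of `ℝ≥0∞`-valued functions. -/
theorem lintegral_Lp_tsum_le {α ι : Type*} [MeasurableSpace α] [Countable ι] {μ : Measure α}
    {f : ι → α → ℝ≥0∞} (hf : ∀ i, Measurable (f i)) {r : ℝ} (hr : 1 ≤ r) :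
    (∫⁻ x, (∑' i, f i x) ^ r ∂μ) ^ (1 / r) ≤ ∑' i, (∫⁻ x, f i x ^ r ∂μ) ^ (1 / r) := by
  classical
  have hr0 : 0 < r := zero_lt_one.trans_le hr
  have finite_sum (s : Finset ι) : (∫⁻ x, (∑ i ∈ s, f i x) ^ r ∂μ) ^ (1 / r) ≤
      ∑ i ∈ s, (∫⁻ x, f i x ^ r ∂μ) ^ (1 / r) := by
    induction s using Finset.induction_on with
    | empty => simp [hr0]
    | insert i s his ih =>
      simp only [Finset.sum_insert his]
      have h := ENNReal.lintegral_Lp_add_le (μ := μ) (hf i).aemeasurable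
        (s.measurable_fun_sum fun j _ => hf j).aemeasurable hr
      exact h.trans (by gcongr)
  have hsup (x : α) : (∑' i, f i x) ^ r = ⨆ s : Finset ι, (∑ i ∈ s, f i x) ^ r := by
    rw [ENNReal.tsum_eq_iSup_sum]
    exact (ENNReal.orderIsoRpow r hr0).map_iSup _
  simp_rw [hsup]
  rw [lintegral_iSup_directed_of_measurable
    (fun s => (s.measurable_fun_sum fun j _ => hf j).pow_const r)]
  · rw [one_div, ENNReal.rpow_inv_le_iff hr0]
    refine iSup_le fun s => ?_
    rw [← ENNReal.rpow_inv_le_iff hr0, ← one_div]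
    exact (finite_sum s).trans (ENNReal.sum_le_tsum s)
  · refine Monotone.directed_le fun s t hst x => ?_
    exact ENNReal.rpow_le_rpow (Finset.sum_le_sum_of_subset hst) hr0.le

/-- The reverse Minkowski inequality for countable sums and exponents at most one. -/
theorem tsum_lintegral_Lp_le {α ι : Type*} [MeasurableSpace α] [Countable ι] {μ : Measure α}
    {f : ι → α → ℝ≥0∞} (hf : ∀ i, Measurable (f i)) {r : ℝ} (hr0 : 0 < r) (hr : r ≤ 1) :
    ∑' i, (∫⁻ x, f i x ^ r ∂μ) ^ (1 / r) ≤ (∫⁻ x, (∑' i, f i x) ^ r ∂μ) ^ (1 / r) := by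
  set F : α → ℝ≥0∞ := fun x => ∑' i, f i x
  have hFm : Measurable F := Measurable.tsum hf
  set I := ∫⁻ x, F x ^ r ∂μ
  rcases eq_or_ne I ⊤ with htop | htop
  · simp [htop, hr0]
  have hfin : ∀ᵐ x ∂μ, F x ≠ ⊤ := by
    filter_upwards [ae_lt_top (hFm.pow_const r) htop] with x hx hx'
    simp [hx', hr0] at hx
  have hmul {a b : ℝ≥0∞} (hab : a ≤ b) (hb : b ≠ ⊤) :
      a ^ r = (a * b ^ (r - 1)) ^ r * (b ^ r) ^ (1 - r) := by
    rcases eq_or_ne b 0 with rfl | hb0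
    · simp [nonpos_iff_eq_zero.1 hab, hr0]
    rw [ENNReal.mul_rpow_of_nonneg _ _ hr0.le, mul_assoc, ← ENNReal.rpow_mul, ← ENNReal.rpow_mul,
      ← ENNReal.rpow_add _ _ hb0 hb, show (r - 1) * r + r * (1 - r) = 0 by ring, ENNReal.rpow_zero,
      mul_one]
  have hterm (i : ι) : (∫⁻ x, f i x ^ r ∂μ) ^ (1 / r) ≤
      (∫⁻ x, f i x * F x ^ (r - 1) ∂μ) * I ^ ((1 - r) / r) := by
    have h := ENNReal.lintegral_mul_norm_pow_le (μ := μ)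
      ((hf i).mul (hFm.pow_const (r - 1))).aemeasurable (hFm.pow_const r).aemeasurable
      hr0.le (sub_nonneg.2 hr) (add_sub_cancel r 1)
    rw [one_div, ENNReal.rpow_inv_le_iff hr0, ENNReal.mul_rpow_of_nonneg _ _ hr0.le,
      ← ENNReal.rpow_mul, div_mul_cancel₀ _ hr0.ne']
    refine le_trans (le_of_eq (lintegral_congr_ae ?_)) h
    filter_upwards [hfin] with x hx
    exact hmul (ENNReal.le_tsum i) hx
  have hsum : ∑' i, ∫⁻ x, f i x * F x ^ (r - 1) ∂μ = I := by
    rw [← lintegral_tsum fun i => by fun_prop]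
    refine lintegral_congr_ae ?_
    filter_upwards [hfin] with x hx
    rw [ENNReal.tsum_mul_right]
    change F x * F x ^ (r - 1) = F x ^ r
    rcases eq_or_ne (F x) 0 with h0 | h0
    · simp [h0, hr0]
    · conv_lhs => rw [← ENNReal.rpow_one (F x), ← ENNReal.rpow_mul, ← ENNReal.rpow_add _ _ h0 hx]
      congr 1
      ring
  calc ∑' i, (∫⁻ x, f i x ^ r ∂μ) ^ (1 / r)
      ≤ ∑' i, (∫⁻ x, f i x * F x ^ (r - 1) ∂μ) * I ^ ((1 - r) / r) := ENNReal.tsum_le_tsum hterm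
    _ = I ^ (1 : ℝ) * I ^ ((1 - r) / r) := by rw [ENNReal.tsum_mul_right, hsum, ENNReal.rpow_one]
    _ = I ^ (1 / r) := by
      rw [← ENNReal.rpow_add_of_nonneg _ _ zero_le_one (div_nonneg (sub_nonneg.2 hr) hr0.le)]
      congr 1
      field_simp
      ring

theorem dyCube_eq_pi (N : ℕ) (k : ℤ) (x : EucN N) :
    dyCube N k x = univ.pi fun i => Ico (x i) (x i + (2 : ℝ) ^ (-k)) := by
  ext y
  simp [dyCube]

theorem DyadicLattice.countable_cubes {N : ℕ} (D : DyadicLattice N) : D.cubes.Countable := by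
  refine countable_iUnion fun k => (D.pairwiseDisjoint k).countable_of_nonempty_interior ?_
  intro Q hQ
  obtain ⟨x, rfl⟩ := D.cube_form k Q hQ
  rw [id, dyCube_eq_pi, interior_pi_set finite_univ]
  simp only [interior_Ico]
  exact univ_pi_nonempty_iff.2 fun i => nonempty_Ioo.2 (lt_add_of_pos_right _ (by positivity))

theorem DyadicLattice.exists_eq_dyCube {N : ℕ} (D : DyadicLattice N) {Q : Set (EucN N)}
    (hQ : Q ∈ D.cubes) : ∃ k x, Q = dyCube N k x := by
  obtain ⟨k, hk⟩ := mem_iUnion.1 hQ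
  exact ⟨k, D.cube_form k Q hk⟩

theorem DyadicLattice.measurableSet_of_mem_cubes {N : ℕ} (D : DyadicLattice N)
    {Q : Set (EucN N)} (hQ : Q ∈ D.cubes) : MeasurableSet Q := by
  obtain ⟨k, x, rfl⟩ := D.exists_eq_dyCube hQ
  rw [dyCube_eq_pi]
  exact MeasurableSet.univ_pi fun i => measurableSet_Ico

theorem DyadicLattice.measure_ne_top_of_mem_cubes {N : ℕ} (D : DyadicLattice N)
    {Q : Set (EucN N)} (hQ : Q ∈ D.cubes) (μ : Measure (EucN N)) [IsLocallyFiniteMeasure μ] :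
    μ Q ≠ ⊤ := by
  obtain ⟨k, x, rfl⟩ := D.exists_eq_dyCube hQ
  rw [dyCube_eq_pi]
  exact (Bornology.IsBounded.pi fun i => Metric.isBounded_Ico _ _).measure_lt_top.ne

theorem measurable_const_mul_indE {N : ℕ} {Q : Set (EucN N)} (hQ : MeasurableSet Q) (c : ℝ≥0∞) :
    Measurable fun x => c * indE Q x :=
  (measurable_one.indicator hQ).const_mul c

/-- The `L^p` norm of a single multiple of an indicator function. -/
theorem lintegral_const_mul_indE_rpow {N : ℕ} {μ : Measure (EucN N)} {Q : Set (EucN N)}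
    (hQ : MeasurableSet Q) (c : ℝ≥0∞) {p : ℝ} (hp : 0 < p) :
    (∫⁻ x, ((c * indE Q x) ^ 2) ^ (p / 2) ∂μ) ^ (1 / (p / 2)) = (c * μ Q ^ (1 / p)) ^ 2 := by
  have h (x : EucN N) : ((c * indE Q x) ^ 2) ^ (p / 2) = Q.indicator (fun _ => c ^ p) x := by
    rw [← ENNReal.rpow_ofNat, ← ENNReal.rpow_mul, mul_div_cancel₀ _ two_ne_zero]
    by_cases hx : x ∈ Q <;> simp [indE, hx, hp]
  simp_rw [h]
  rw [lintegral_indicator_const hQ, ← ENNReal.rpow_two,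
    ENNReal.mul_rpow_of_nonneg _ _ (by positivity), ENNReal.mul_rpow_of_nonneg _ _ zero_le_two,
    ← ENNReal.rpow_mul, ← ENNReal.rpow_mul]
  congr 2 <;> field_simp

theorem sqNorm_eq_rpow {N : ℕ} {ι : Type*} (μ : Measure (EucN N)) (p : ℝ)
    (f : ι → EucN N → ℝ≥0∞) :
    sqNorm μ p f = ((∫⁻ x, (∑' i, f i x ^ 2) ^ (p / 2) ∂μ) ^ (1 / (p / 2))) ^ (1 / 2 : ℝ) := by
  rw [sqNorm, ← ENNReal.rpow_mul]
  congr 1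
  ring

theorem sqNorm_le_tsum {N : ℕ} {ι : Type*} [Countable ι] {μ : Measure (EucN N)} {p : ℝ}
    (hp : 2 ≤ p) {Q : ι → Set (EucN N)} (hQ : ∀ i, MeasurableSet (Q i)) (c : ι → ℝ≥0∞) :
    sqNorm μ p (fun i x => c i * indE (Q i) x) ≤
      (∑' i, (c i * μ (Q i) ^ (1 / p)) ^ 2) ^ (1 / 2 : ℝ) := by
  rw [sqNorm_eq_rpow]
  refine ENNReal.rpow_le_rpow ?_ (by norm_num)
  refine (lintegral_Lp_tsum_le
    (fun i => (measurable_const_mul_indE (hQ i) (c i)).pow_const 2) (by linarith)).trans_eq ?_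
  exact tsum_congr fun i => lintegral_const_mul_indE_rpow (hQ i) (c i) (by linarith)

theorem tsum_le_sqNorm {N : ℕ} {ι : Type*} [Countable ι] {μ : Measure (EucN N)} {p : ℝ}
    (hp0 : 0 < p) (hp : p ≤ 2) {Q : ι → Set (EucN N)} (hQ : ∀ i, MeasurableSet (Q i))
    (c : ι → ℝ≥0∞) :
    (∑' i, (c i * μ (Q i) ^ (1 / p)) ^ 2) ^ (1 / 2 : ℝ) ≤
      sqNorm μ p (fun i x => c i * indE (Q i) x) := by
  rw [sqNorm_eq_rpow]
  refine ENNReal.rpow_le_rpow ?_ (by norm_num)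
  refine Eq.trans_le ?_ (tsum_lintegral_Lp_le
    (fun i => (measurable_const_mul_indE (hQ i) (c i)).pow_const 2) (by linarith) (by linarith))
  exact tsum_congr fun i => (lintegral_const_mul_indE_rpow (hQ i) (c i) hp0).symm

theorem sqNorm_eq_of_forall_ne {N : ℕ} {ι : Type*} {μ : Measure (EucN N)} {p : ℝ} (hp : 0 < p)
    {Q : ι → Set (EucN N)} (i : ι) (hQ : MeasurableSet (Q i)) {c : ι → ℝ≥0∞}
    (hc : ∀ j, j ≠ i → c j = 0) :
    sqNorm μ p (fun i x => c i * indE (Q i) x) = c i * μ (Q i) ^ (1 / p) := by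
  rw [sqNorm_eq_rpow]
  have h (x : EucN N) : ∑' j, (c j * indE (Q j) x) ^ 2 = (c i * indE (Q i) x) ^ 2 :=
    tsum_eq_single i fun j hj => by simp [hc j hj]
  simp_rw [h]
  rw [lintegral_const_mul_indE_rpow hQ _ hp, ← ENNReal.rpow_ofNat, ← ENNReal.rpow_mul]
  norm_num

/-- If `1 < p ≤ 2 ≤ q < ∞`, then the quadratic `𝒜_{p,q}` constant equals
the simple `A_{p,q}` constant: `[σ,w]_{p,q} = (σ,w)_{p,q}`. -/
theorem quadratic_eq_simple_Apq (p q : ℝ) (N : ℕ) (hp : 1 < p) (hp2 : p ≤ 2)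
    (hq2 : 2 ≤ q) (hN : 1 ≤ N) (D : DyadicLattice N) (σ w : Measure (EucN N))
    (hσ : IsLocallyFiniteMeasure σ) (hw : IsLocallyFiniteMeasure w) :
    sqA D σ w p q = simpleA D σ w p q := by
  have hp0 : 0 < p := by linarith
  have hpinv : 0 < 1 - 1 / p := by rw [sub_pos, div_lt_one hp0]; exact hp
  have : Countable D.cubes := D.countable_cubes
  have hmeas (Q : D.cubes) : MeasurableSet (Q : Set (EucN N)) :=
    D.measurableSet_of_mem_cubes Q.2
  have hsplit (t : ℝ≥0∞) : t = t ^ (1 / p) * t ^ (1 - 1 / p) := by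
    rw [← ENNReal.rpow_add_of_nonneg _ _ (by positivity) hpinv.le, add_sub_cancel,
      ENNReal.rpow_one]
  have hcube (b s v W : ℝ≥0∞) :
      b * s / v * W = s ^ (1 - 1 / p) * W / v * (b * s ^ (1 / p)) := by
    conv_lhs => rw [hsplit s]
    simp only [div_eq_mul_inv]
    ring
  apply le_antisymm
  · refine sInf_le fun a => ?_
    refine (sqNorm_le_tsum hq2 hmeas _).trans ?_
    refine le_trans ?_ (mul_le_mul_right (tsum_le_sqNorm hp0 hp2 hmeas _) _)
    rw [← ENNReal.rpow_le_rpow_iff (z := 2) two_pos, ENNReal.mul_rpow_of_nonneg _ _ zero_le_two,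
      ← ENNReal.rpow_mul, ← ENNReal.rpow_mul]
    norm_num only [ENNReal.rpow_one]
    rw [ENNReal.rpow_ofNat, ← ENNReal.tsum_mul_left]
    refine ENNReal.tsum_le_tsum fun Q => ?_
    rw [← mul_pow, hcube]
    gcongr
    exact le_iSup₂_of_le Q.1 Q.2 le_rfl
  · refine le_sInf fun C hC => iSup₂_le fun Q hQ => ?_
    rcases eq_or_ne (σ Q) 0 with h0 | h0
    · rw [h0, ENNReal.zero_rpow_of_pos hpinv]
      simp
    have h := hC (Pi.single Q 1)
    have hne (R : D.cubes) (hR : R ≠ ⟨Q, hQ⟩) :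
        (Pi.single Q 1 : Set (EucN N) → ℝ) R = 0 :=
      Pi.single_eq_of_ne (fun h => hR (Subtype.ext h)) _
    rw [sqNorm_eq_of_forall_ne (by linarith) ⟨Q, hQ⟩ (hmeas _) (fun R hR => by simp [hne R hR]),
      sqNorm_eq_of_forall_ne hp0 ⟨Q, hQ⟩ (hmeas _) (fun R hR => by simp [hne R hR]), hcube] at h
    have hσQ := D.measure_ne_top_of_mem_cubes hQ σ
    simp only [Pi.single_eq_same, nnnorm_one, ENNReal.coe_one, one_mul] at h
    exact (ENNReal.mul_le_mul_iff_left (by simp [h0, hσQ]) (by simp [h0, hσQ])).1 h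

end
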